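/- arXiv:2604.05637 — 2 statements merged into one kernel-verified Lean document; each statement's English description precedes it below -/
import Mathlib

section
/- Let d ≥ 1, let μ be the Haar probability measure on the unitary group U(d), and let ρ ∈ ℂ^{d×d} be a rank-one orthogonal projection (i.e., ρ = ψψ* for some unit vector ψ). Then for all matrices A, B ∈ ℂ^{d×d}, ∫_{U(d)} Tr(U ρ U* A)·Tr(U ρ U* B) dμ(U) = (Tr(AB) + Tr(A)·Tr(B)) / (d(d+1)). -/
open Matrix MeasureTheory

/-- The reflection of `ℂ^n` in the hyperplane orthogonal to `e i - 2 e j`. -/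
theorem one_sub_vecMulVec_mem_unitaryGroup {n : Type*} [Fintype n] [DecidableEq n]
    {i j : n} (hij : i ≠ j) :
    (1 - (2 / 5 : ℂ) • vecMulVec (Pi.single i 1 - Pi.single j 2) (Pi.single i 1 - Pi.single j 2) :
      Matrix n n ℂ) ∈ unitaryGroup n ℂ := by
  set u : n → ℂ := Pi.single i 1 - Pi.single j 2 with hu
  have hstar : star u = u := by
    ext k
    by_cases h1 : k = i
    · subst h1
      simp [hu, hij]
    · by_cases h2 : k = j <;> simp [hu, Pi.single_apply, h1, h2]
  have hdot : u ⬝ᵥ u = 5 := by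
    simp [hu, hij, hij.symm]
    norm_num
  have hsa : star (vecMulVec u u) = vecMulVec u u := by
    rw [star_eq_conjTranspose, conjTranspose_vecMulVec, hstar]
  have hsq : vecMulVec u u * vecMulVec u u = (5 : ℂ) • vecMulVec u u := by
    rw [vecMulVec_mul_vecMulVec, hdot]
    simp [vecMulVec_smul]
  rw [mem_unitaryGroup_iff, star_sub, star_one, star_smul, hsa, mul_sub, sub_mul, sub_mul,
    smul_mul_smul_comm, hsq, mul_one, one_mul, mul_one]
  have h2 : star (2 / 5 : ℂ) = 2 / 5 := by simp
  rw [h2]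
  module

/-- The diagonal matrix with a single entry `I` and all others `1`. -/
theorem diagonal_update_I_mem_unitaryGroup {n : Type*} [Fintype n] [DecidableEq n] (p : n) :
    (diagonal (fun k => if k = p then Complex.I else 1) : Matrix n n ℂ) ∈ unitaryGroup n ℂ := by
  rw [mem_unitaryGroup_iff, star_eq_conjTranspose, diagonal_conjTranspose, diagonal_mul_diagonal,
    ← diagonal_one]
  congr 1
  ext k
  by_cases h : k = p <;> simp [h]

theorem sum_normSq_unitary_mulVec {n : Type*} [Fintype n] [DecidableEq n]
    (U : unitaryGroup n ℂ) (ψ : n → ℂ) :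
    ∑ i, star ((U : Matrix n n ℂ) *ᵥ ψ) i * ((U : Matrix n n ℂ) *ᵥ ψ) i = star ψ ⬝ᵥ ψ := by
  change star ((U : Matrix n n ℂ) *ᵥ ψ) ⬝ᵥ ((U : Matrix n n ℂ) *ᵥ ψ) = _
  rw [star_mulVec, dotProduct_mulVec, vecMul_vecMul, ← star_eq_conjTranspose,
    UnitaryGroup.star_mul_self, vecMul_one]

theorem trace_conj_vecMulVec_mul {n : Type*} [Fintype n] (U A : Matrix n n ℂ) (ψ : n → ℂ) :
    (U * vecMulVec ψ (star ψ) * star U * A).trace =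
      ∑ i, ∑ j, A i j * (star (U *ᵥ ψ) i * (U *ᵥ ψ) j) := by
  rw [mul_vecMulVec, vecMulVec_mul, star_eq_conjTranspose, ← star_mulVec, vecMulVec_mul,
    trace_vecMulVec, dotProduct_comm, ← dotProduct_mulVec]
  generalize U *ᵥ ψ = v
  simp only [dotProduct, mulVec, Finset.mul_sum]
  exact Finset.sum_congr rfl fun i _ => Finset.sum_congr rfl fun j _ => by ring

section Moments

variable {n : Type*} [Fintype n] [DecidableEq n] [MeasurableSpace (unitaryGroup n ℂ)]

/-- The moment `𝔼[conj vᵢ · vⱼ · conj vₖ · vₗ]` of the random vector `v = Uψ`. -/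
noncomputable def fourthMoment (μ : Measure (unitaryGroup n ℂ)) (ψ : n → ℂ) (i j k l : n) : ℂ :=
  ∫ U : unitaryGroup n ℂ,
    star ((U : Matrix n n ℂ) *ᵥ ψ) i * ((U : Matrix n n ℂ) *ᵥ ψ) j *
      (star ((U : Matrix n n ℂ) *ᵥ ψ) k * ((U : Matrix n n ℂ) *ᵥ ψ) l) ∂μ

theorem fourthMoment_swap_star (μ : Measure (unitaryGroup n ℂ)) (ψ : n → ℂ) (i j k l : n) :
    fourthMoment μ ψ i j k l = fourthMoment μ ψ k j i l := by
  unfold fourthMoment; congr 1; ext U; ring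

theorem fourthMoment_swap (μ : Measure (unitaryGroup n ℂ)) (ψ : n → ℂ) (i j k l : n) :
    fourthMoment μ ψ i j k l = fourthMoment μ ψ i l k j := by
  unfold fourthMoment; congr 1; ext U; ring

variable [BorelSpace (unitaryGroup n ℂ)] (μ : Measure (unitaryGroup n ℂ))

theorem integrable_fourthMoment [IsFiniteMeasure μ] (ψ : n → ℂ) (i j k l : n) :
    Integrable (fun U : unitaryGroup n ℂ =>
      star ((U : Matrix n n ℂ) *ᵥ ψ) i * ((U : Matrix n n ℂ) *ᵥ ψ) j *
        (star ((U : Matrix n n ℂ) *ᵥ ψ) k * ((U : Matrix n n ℂ) *ᵥ ψ) l)) μ := by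
  have hb (U : unitaryGroup n ℂ) (i : n) : ‖((U : Matrix n n ℂ) *ᵥ ψ) i‖ ≤ ∑ x, ‖ψ x‖ := by
    refine (norm_sum_le _ _).trans (Finset.sum_le_sum fun x _ => ?_)
    rw [norm_mul]
    exact mul_le_of_le_one_left (norm_nonneg _) (entry_norm_bound_of_unitary U.2 i x)
  have hc : Continuous fun U : unitaryGroup n ℂ => (U : Matrix n n ℂ) *ᵥ ψ :=
    continuous_subtype_val.matrix_mulVec continuous_const
  have hci (i : n) : Continuous fun U : unitaryGroup n ℂ => ((U : Matrix n n ℂ) *ᵥ ψ) i :=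
    (continuous_apply i).comp hc
  set C := ∑ x, ‖ψ x‖
  have hC : 0 ≤ C := Finset.sum_nonneg fun x _ => norm_nonneg _
  refine Integrable.of_bound (C := C * C * (C * C)) (Continuous.aestronglyMeasurable ?_)
    (Filter.Eventually.of_forall fun U => ?_)
  · simp only [Pi.star_apply]
    have := hci i; have := hci j; have := hci k; have := hci l
    fun_prop
  · simp only [norm_mul, Pi.star_apply, norm_star]
    gcongr <;> exact hb U _

theorem integral_comp_unitary_mulVec [μ.IsMulLeftInvariant] (ψ : n → ℂ)
    (W : unitaryGroup n ℂ) (f : (n → ℂ) → ℂ) :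
    ∫ U : unitaryGroup n ℂ, f ((W : Matrix n n ℂ) *ᵥ ((U : Matrix n n ℂ) *ᵥ ψ)) ∂μ =
      ∫ U : unitaryGroup n ℂ, f ((U : Matrix n n ℂ) *ᵥ ψ) ∂μ := by
  rw [← integral_mul_left_eq_self (fun U : unitaryGroup n ℂ => f ((U : Matrix n n ℂ) *ᵥ ψ)) W]
  simp [mulVec_mulVec]

theorem fourthMoment_phase [μ.IsMulLeftInvariant] (ψ : n → ℂ) (p i j k l : n) :
    ((if i = p then -Complex.I else 1) * (if j = p then Complex.I else 1) *
      ((if k = p then -Complex.I else 1) * (if l = p then Complex.I else 1))) *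
        fourthMoment μ ψ i j k l = fourthMoment μ ψ i j k l := by
  conv_rhs => rw [fourthMoment]
  rw [← integral_comp_unitary_mulVec μ ψ ⟨_, diagonal_update_I_mem_unitaryGroup p⟩
    (fun v => star v i * v j * (star v k * v l)), fourthMoment, ← integral_const_mul]
  congr 1
  ext U
  simp only [Pi.star_apply, mulVec_diagonal, star_mul', apply_ite star, star_one,
    Complex.star_def, Complex.conj_I]
  ring

theorem fourthMoment_eq_zero [μ.IsMulLeftInvariant] (ψ : n → ℂ) {i j k l : n}
    (hij : i ≠ j) (hil : i ≠ l) : fourthMoment μ ψ i j k l = 0 := by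
  have h := fourthMoment_phase μ ψ i i j k l
  have hne : (1 + Complex.I) ≠ 0 := fun h => by simpa using congrArg Complex.im h
  by_cases hki : k = i
  · simp [hij.symm, hil.symm, hki] at h
    subst hki
    linear_combination (-1 / 2 : ℂ) * h
  · simp [hij.symm, hil.symm, hki] at h
    refine (mul_eq_zero.mp (?_ : (1 + Complex.I) * _ = 0)).resolve_left hne
    linear_combination -h

theorem fourthMoment_eq_zero' [μ.IsMulLeftInvariant] (ψ : n → ℂ) {i j k l : n}
    (hji : j ≠ i) (hjk : j ≠ k) : fourthMoment μ ψ i j k l = 0 := by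
  have h := fourthMoment_phase μ ψ j i j k l
  have hne : (1 - Complex.I) ≠ 0 := fun h => by simpa using congrArg Complex.im h
  by_cases hlj : l = j
  · simp [hji.symm, hjk.symm, hlj] at h
    subst hlj
    linear_combination (-1 / 2 : ℂ) * h
  · simp [hji.symm, hjk.symm, hlj] at h
    refine (mul_eq_zero.mp (?_ : (1 - Complex.I) * _ = 0)).resolve_left hne
    linear_combination -h

theorem fourthMoment_reflect [IsFiniteMeasure μ] [μ.IsMulLeftInvariant] (ψ : n → ℂ) {i j : n}
    (hij : i ≠ j) :
    81 * fourthMoment μ ψ i i i i + 256 * fourthMoment μ ψ j j j j +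
      576 * fourthMoment μ ψ i i j j = 625 * fourthMoment μ ψ i i i i := by
  have h : fourthMoment μ ψ i i i i = ∑ x : Fin 2, ∑ y : Fin 2, ∑ z : Fin 2, ∑ w : Fin 2,
      (![3 / 5, 4 / 5] x * ![3 / 5, 4 / 5] y * (![3 / 5, 4 / 5] z * ![3 / 5, 4 / 5] w) : ℂ) *
        fourthMoment μ ψ (![i, j] x) (![i, j] y) (![i, j] z) (![i, j] w) := by
    conv_lhs => rw [fourthMoment]
    rw [← integral_comp_unitary_mulVec μ ψ ⟨_, one_sub_vecMulVec_mem_unitaryGroup hij⟩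
      (fun v => star v i * v i * (star v i * v i))]
    simp only [fourthMoment, ← integral_const_mul]
    have hint (x y z w : Fin 2) := (integrable_fourthMoment μ ψ (![i, j] x) (![i, j] y)
      (![i, j] z) (![i, j] w)).const_mul
      (![3 / 5, 4 / 5] x * ![3 / 5, 4 / 5] y * (![3 / 5, 4 / 5] z * ![3 / 5, 4 / 5] w) : ℂ)
    have hint1 (x y z : Fin 2) := integrable_finsetSum Finset.univ fun w _ => hint x y z w
    have hint2 (x y : Fin 2) := integrable_finsetSum Finset.univ fun z _ => hint1 x y z
    have hint3 (x : Fin 2) := integrable_finsetSum Finset.univ fun y _ => hint2 x y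
    simp_rw [← integral_finsetSum Finset.univ fun w _ => hint _ _ _ w,
      ← integral_finsetSum Finset.univ fun w _ => hint1 _ _ w,
      ← integral_finsetSum Finset.univ fun w _ => hint2 _ w,
      ← integral_finsetSum Finset.univ fun w _ => hint3 w]
    congr 1
    ext U
    set v := (U : Matrix n n ℂ) *ᵥ ψ
    have hv : ((1 - (2 / 5 : ℂ) • vecMulVec (Pi.single i 1 - Pi.single j 2)
        (Pi.single i 1 - Pi.single j 2) : Matrix n n ℂ) *ᵥ v) i = 3 / 5 * v i + 4 / 5 * v j := by
      simp [sub_mulVec, smul_mulVec, vecMulVec_mulVec, sub_dotProduct, hij]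
      ring
    simp only [Pi.star_apply, hv, Fin.sum_univ_two, star_add, star_mul']
    simp
    ring
  simp only [Fin.sum_univ_two, cons_val_zero, cons_val_one] at h
  have e1 : fourthMoment μ ψ i j j i = fourthMoment μ ψ i i j j := fourthMoment_swap ..
  have e2 : fourthMoment μ ψ j i i j = fourthMoment μ ψ i i j j := fourthMoment_swap_star ..
  have e3 : fourthMoment μ ψ j j i i = fourthMoment μ ψ i i j j := by
    rw [fourthMoment_swap, fourthMoment_swap_star]
  have z1 : fourthMoment μ ψ i i i j = 0 := fourthMoment_swap μ ψ i j i i ▸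
    fourthMoment_eq_zero' μ ψ hij.symm hij.symm
  have z2 : fourthMoment μ ψ i i j i = 0 := fourthMoment_swap_star μ ψ j i i i ▸
    fourthMoment_eq_zero μ ψ hij.symm hij.symm
  have z3 : fourthMoment μ ψ j j j i = 0 := fourthMoment_swap μ ψ j i j j ▸
    fourthMoment_eq_zero' μ ψ hij hij
  have z4 : fourthMoment μ ψ j j i j = 0 := fourthMoment_swap_star μ ψ i j j j ▸
    fourthMoment_eq_zero μ ψ hij hij
  rw [e1, e2, e3, z1, z2, z3, z4,
    fourthMoment_eq_zero μ ψ (k := i) hij.symm hij.symm,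
    fourthMoment_eq_zero μ ψ (k := j) hij hij,
    fourthMoment_eq_zero' μ ψ (l := i) hij.symm hij.symm,
    fourthMoment_eq_zero' μ ψ (l := j) hij hij,
    fourthMoment_eq_zero μ ψ (k := i) hij hij,
    fourthMoment_eq_zero μ ψ (k := j) hij.symm hij.symm] at h
  linear_combination -625 * h

theorem sum_fourthMoment [IsProbabilityMeasure μ] (ψ : n → ℂ) :
    ∑ i, ∑ k, fourthMoment μ ψ i i k k = (star ψ ⬝ᵥ ψ) ^ 2 := by
  have hint (i k : n) := integrable_fourthMoment μ ψ i i k k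
  simp_rw [fourthMoment, ← integral_finsetSum Finset.univ fun k _ => hint _ k,
    ← integral_finsetSum Finset.univ fun i _ =>
      integrable_finsetSum Finset.univ fun k _ => hint i k,
    ← Finset.sum_mul_sum, sum_normSq_unitary_mulVec]
  simp [sq]

theorem fourthMoment_diagonal_eq [IsFiniteMeasure μ] [μ.IsMulLeftInvariant] (ψ : n → ℂ) (i j : n) :
    fourthMoment μ ψ i i i i = fourthMoment μ ψ j j j j := by
  by_cases hij : i = j
  · rw [hij]
  have h1 := fourthMoment_reflect μ ψ hij
  have h2 := fourthMoment_reflect μ ψ (Ne.symm hij)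
  rw [fourthMoment_swap μ ψ j j i i, fourthMoment_swap_star μ ψ j i i j] at h2
  linear_combination (-1 / 800 : ℂ) * (h1 - h2)

theorem fourthMoment_eq_half [IsFiniteMeasure μ] [μ.IsMulLeftInvariant] (ψ : n → ℂ) (m : n)
    {i j : n} (hij : i ≠ j) :
    fourthMoment μ ψ i i j j = fourthMoment μ ψ m m m m / 2 := by
  have h := fourthMoment_reflect μ ψ hij
  rw [fourthMoment_diagonal_eq μ ψ i m, fourthMoment_diagonal_eq μ ψ j m] at h
  linear_combination (1 / 576 : ℂ) * h

theorem fourthMoment_eq_ite [IsFiniteMeasure μ] [μ.IsMulLeftInvariant] (ψ : n → ℂ)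
    (m i j k l : n) :
    fourthMoment μ ψ i j k l = fourthMoment μ ψ m m m m / 2 *
      ((if i = j then 1 else 0) * (if k = l then 1 else 0) +
        (if i = l then 1 else 0) * (if k = j then 1 else 0)) := by
  by_cases hij : i = j
  · subst hij
    by_cases hkl : k = l
    · subst hkl
      by_cases hik : i = k
      · subst hik
        simp [fourthMoment_diagonal_eq μ ψ i m]
        ring
      · simp [hik, fourthMoment_eq_half μ ψ m hik]
    · have h0 : fourthMoment μ ψ i i k l = 0 := by
        by_cases hki : k = i
        · rw [fourthMoment_swap]
          exact fourthMoment_eq_zero' μ ψ (fun h => hkl (hki.trans h.symm)) (Ne.symm hkl)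
        · rw [fourthMoment_swap_star]
          exact fourthMoment_eq_zero μ ψ hki hkl
      rw [h0]
      by_cases hki : k = i
      · subst hki
        simp [hkl]
      · simp [hkl, hki]
  · by_cases hil : i = l
    · subst hil
      by_cases hkj : k = j
      · subst hkj
        rw [fourthMoment_swap, fourthMoment_eq_half μ ψ m hij]
        simp [hij]
      · rw [fourthMoment_eq_zero' μ ψ (Ne.symm hij) (Ne.symm hkj)]
        simp [hij, hkj]
    · simp [hij, hil, fourthMoment_eq_zero μ ψ hij hil]

theorem fourthMoment_diagonal [IsProbabilityMeasure μ] [μ.IsMulLeftInvariant] {ψ : n → ℂ}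
    (hψ : star ψ ⬝ᵥ ψ = 1) (m : n) :
    fourthMoment μ ψ m m m m / 2 = 1 / (Fintype.card n * (Fintype.card n + 1)) := by
  have h := sum_fourthMoment μ ψ
  rw [hψ] at h
  rw [Finset.sum_congr rfl fun i _ => Finset.sum_congr rfl fun k _ =>
    fourthMoment_eq_ite μ ψ m i i k k] at h
  simp_rw [← Finset.mul_sum] at h
  simp [Finset.sum_add_distrib] at h
  have hn : (Fintype.card n : ℂ) ≠ 0 := by
    have : Nonempty n := ⟨m⟩
    exact_mod_cast Fintype.card_ne_zero
  have hn1 : (Fintype.card n + 1 : ℂ) ≠ 0 := Nat.cast_add_one_ne_zero _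
  field_simp
  linear_combination 2 * h

theorem integral_trace_mul_trace [IsProbabilityMeasure μ] [μ.IsMulLeftInvariant] [Nonempty n]
    {ψ : n → ℂ} (hψ : star ψ ⬝ᵥ ψ = 1) (A B : Matrix n n ℂ) :
    ∫ U : unitaryGroup n ℂ,
        ((U : Matrix n n ℂ) * vecMulVec ψ (star ψ) * star (U : Matrix n n ℂ) * A).trace *
        ((U : Matrix n n ℂ) * vecMulVec ψ (star ψ) * star (U : Matrix n n ℂ) * B).trace ∂μ =
      ((A * B).trace + A.trace * B.trace) / (Fintype.card n * (Fintype.card n + 1)) := by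
  obtain ⟨m⟩ := ‹Nonempty n›
  have hint (p q : n × n) :=
    (integrable_fourthMoment μ ψ p.1 p.2 q.1 q.2).const_mul (A p.1 p.2 * B q.1 q.2)
  have hexp (U : unitaryGroup n ℂ) :
      ((U : Matrix n n ℂ) * vecMulVec ψ (star ψ) * star (U : Matrix n n ℂ) * A).trace *
        ((U : Matrix n n ℂ) * vecMulVec ψ (star ψ) * star (U : Matrix n n ℂ) * B).trace =
      ∑ p : n × n, ∑ q : n × n, A p.1 p.2 * B q.1 q.2 *
        (star ((U : Matrix n n ℂ) *ᵥ ψ) p.1 * ((U : Matrix n n ℂ) *ᵥ ψ) p.2 *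
          (star ((U : Matrix n n ℂ) *ᵥ ψ) q.1 * ((U : Matrix n n ℂ) *ᵥ ψ) q.2)) := by
    rw [trace_conj_vecMulVec_mul, trace_conj_vecMulVec_mul, ← Fintype.sum_prod_type',
      ← Fintype.sum_prod_type', Finset.sum_mul_sum]
    exact Finset.sum_congr rfl fun p _ => Finset.sum_congr rfl fun q _ => by ring
  simp_rw [hexp]
  rw [integral_finsetSum _ fun p _ => integrable_finsetSum _ fun q _ => hint p q]
  simp_rw [integral_finsetSum _ fun q _ => hint _ q, integral_const_mul]
  change ∑ p : n × n, ∑ q : n × n, A p.1 p.2 * B q.1 q.2 *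
    fourthMoment μ ψ p.1 p.2 q.1 q.2 = _
  rw [Finset.sum_congr rfl fun p _ => Finset.sum_congr rfl fun q _ => congrArg _
    (fourthMoment_eq_ite μ ψ m p.1 p.2 q.1 q.2)]
  simp_rw [fourthMoment_diagonal μ hψ m,
    mul_left_comm _ (1 / _ : ℂ), ← Finset.mul_sum, Fintype.sum_prod_type]
  rw [one_div, div_eq_inv_mul]
  congr 1
  simp only [mul_add, Finset.sum_add_distrib, trace, diag, mul_apply, Finset.sum_mul_sum]
  rw [add_comm]
  congr 1
  · simp
  · simp

end Moments

/-- second moment over the unitary group. For the Haar probability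
measure `μ` on `U(d)`, a rank-one orthogonal projection `ρ = ψψ*` (with `ψ` a unit
vector) and all `A, B ∈ ℂ^{d×d}`,
`∫ Tr(U ρ U* A)·Tr(U ρ U* B) dμ(U) = (Tr(AB) + Tr(A)Tr(B)) / (d(d+1))`. -/
theorem stmt10 (d : ℕ) (hd : 1 ≤ d)
    [MeasurableSpace (Matrix.unitaryGroup (Fin d) ℂ)]
    [BorelSpace (Matrix.unitaryGroup (Fin d) ℂ)]
    (μ : Measure (Matrix.unitaryGroup (Fin d) ℂ))
    [μ.IsHaarMeasure] [IsProbabilityMeasure μ]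
    (ψ : Fin d → ℂ) (hψ : ∑ x, ‖ψ x‖ ^ 2 = 1)
    (ρ : Matrix (Fin d) (Fin d) ℂ) (hρ : ρ = Matrix.vecMulVec ψ (star ψ))
    (A B : Matrix (Fin d) (Fin d) ℂ) :
    ∫ U : Matrix.unitaryGroup (Fin d) ℂ,
        ((U : Matrix (Fin d) (Fin d) ℂ) * ρ * star (U : Matrix (Fin d) (Fin d) ℂ) * A).trace *
        ((U : Matrix (Fin d) (Fin d) ℂ) * ρ * star (U : Matrix (Fin d) (Fin d) ℂ) * B).trace ∂μ =
      ((A * B).trace + A.trace * B.trace) / (d * (d + 1)) := by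
  have hψ' : star ψ ⬝ᵥ ψ = 1 := by
    simp only [dotProduct, Pi.star_apply, Complex.star_def, Complex.conj_mul']
    exact_mod_cast hψ
  have : Nonempty (Fin d) := ⟨⟨0, hd⟩⟩
  subst hρ
  simpa using integral_trace_mul_trace μ hψ' A B
end

section
/- Let d ≥ 1, let μ be the Haar probability measure on the unitary group U(d), let ρ ∈ ℂ^{d×d} be a rank-one orthogonal projection, and let A ∈ ℂ^{d×d} be Hermitian. Then the variance of the real random variable U ↦ Tr(U ρ U* A) under μ satisfies Var_μ(Tr(U ρ U* A)) = (Tr(A²) + Tr(A)²)/(d(d+1)) − Tr(A)²/d² ≤ ‖A‖_{HS}²/d². -/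
open Matrix MeasureTheory

/-- A Hermitian idempotent matrix of rank one is `v v*` for a unit vector `v`. -/
lemma exists_unit_vector_of_rank_one {d : ℕ} {ρ : Matrix (Fin d) (Fin d) ℂ}
    (hρ : ρ.IsHermitian) (hρ2 : ρ * ρ = ρ) (hρrank : ρ.rank = 1) :
    ∃ v : Fin d → ℂ, ρ = vecMulVec v (star v) ∧ ∑ i, Complex.normSq (v i) = 1 := by
  have h0 : ρ ≠ 0 := by
    rintro rfl
    simp at hρrank
  rw [Matrix.rank, finrank_eq_one_iff'] at hρrank
  obtain ⟨⟨w, hw⟩, -, hspan⟩ := hρrank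
  have hcol : ∀ j, ∃ c : ℂ, ∀ i, ρ i j = w i * c := by
    intro j
    obtain ⟨c, hc⟩ := hspan ⟨ρ *ᵥ Pi.single j 1, ⟨Pi.single j 1, rfl⟩⟩
    refine ⟨c, fun i ↦ ?_⟩
    have := congrFun (congrArg Subtype.val hc) i
    simp only [SetLike.mk_smul_mk, Pi.smul_apply, smul_eq_mul, mulVec_single_one, col_apply] at this
    rw [← this, mul_comm]
  choose z hz using hcol
  set r : ℝ := ∑ i, Complex.normSq (z i) with hr
  have hr0 : 0 ≤ r := Finset.sum_nonneg fun i _ ↦ Complex.normSq_nonneg _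
  have hsqrt : ((√r : ℝ) : ℂ) * (√r : ℝ) = r := by
    rw [← Complex.ofReal_mul, Real.mul_self_sqrt hr0]
  have hvec : ρ = vecMulVec (fun i ↦ (√r : ℂ) * w i) (star fun i ↦ (√r : ℂ) * w i) := by
    ext i j
    have h1 : ρ i j = ∑ k, ρ i k * star (ρ j k) := by
      conv_lhs => rw [← hρ2, Matrix.mul_apply]
      exact Finset.sum_congr rfl fun k _ ↦ by rw [← hρ.apply k j]
    rw [h1]
    simp only [hz, vecMulVec_apply, Pi.star_apply, star_mul', RCLike.star_def, Complex.conj_ofReal]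
    have h2 : ∀ k, w i * z k * ((starRingEnd ℂ) (w j) * (starRingEnd ℂ) (z k))
        = (w i * (starRingEnd ℂ) (w j)) * (Complex.normSq (z k) : ℂ) := by
      intro k
      rw [← Complex.mul_conj]
      ring
    rw [Finset.sum_congr rfl fun k _ ↦ h2 k, ← Finset.mul_sum, ← Complex.ofReal_sum, ← hr, ← hsqrt]
    ring
  generalize (fun i ↦ (√r : ℂ) * w i) = v at hvec
  refine ⟨v, hvec, ?_⟩
  have hdot : star v ⬝ᵥ v = ((∑ i, Complex.normSq (v i) : ℝ) : ℂ) := by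
    simp only [dotProduct, Pi.star_apply, RCLike.star_def, Complex.ofReal_sum]
    exact Finset.sum_congr rfl fun k _ ↦ by rw [← Complex.mul_conj, mul_comm]
  have hsmul : (((∑ i, Complex.normSq (v i) : ℝ) : ℂ) - 1) • ρ = 0 := by
    have h3 := hρ2
    rw [hvec, vecMulVec_mul_vecMulVec, hdot] at h3
    rw [sub_smul, one_smul, hvec, sub_eq_zero]
    ext i j
    have := congrFun (congrFun h3 i) j
    simp only [vecMulVec_apply, Matrix.smul_apply, Pi.smul_apply, smul_eq_mul] at this ⊢
    linear_combination this
  have := (smul_eq_zero.mp hsmul).resolve_right h0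
  exact_mod_cast sub_eq_zero.mp this

lemma sum_normSq_unitary_mulVec_s12 {d : ℕ} (U : Matrix.unitaryGroup (Fin d) ℂ) (v : Fin d → ℂ) :
    ∑ i, Complex.normSq ((U.1 *ᵥ v) i) = ∑ i, Complex.normSq (v i) := by
  have hdot : ∀ v : Fin d → ℂ, ((∑ i, Complex.normSq (v i) : ℝ) : ℂ) = star v ⬝ᵥ v := by
    intro v
    simp only [dotProduct, Pi.star_apply, RCLike.star_def, Complex.ofReal_sum]
    exact Finset.sum_congr rfl fun k _ ↦ by rw [← Complex.mul_conj, mul_comm]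
  have hU : U.1ᴴ * U.1 = 1 := Matrix.mem_unitaryGroup_iff'.mp U.2
  apply Complex.ofReal_injective
  rw [hdot, hdot, star_mulVec, dotProduct_mulVec, vecMul_vecMul, hU, vecMul_one]

/-- The unitary square root `((1 + i) / 2) + ((1 - i) / 2) S` of the transposition matrix `S`. -/
noncomputable def sqrtSwap {d : ℕ} (i j : Fin d) : Matrix.unitaryGroup (Fin d) ℂ :=
  ⟨((1 + Complex.I) / 2) • 1 + ((1 - Complex.I) / 2) • Matrix.swap ℂ i j, by
    rw [Matrix.mem_unitaryGroup_iff, star_eq_conjTranspose]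
    simp only [conjTranspose_add, conjTranspose_smul, conjTranspose_one, conjTranspose_swap,
      add_mul, mul_add, smul_mul_smul_comm, one_mul, mul_one, swap_mul_self]
    have h1 : (1 + Complex.I) / 2 * star ((1 + Complex.I) / 2) = 1 / 2 := by
      apply Complex.ext <;> simp <;> norm_num
    have h2 : (1 - Complex.I) / 2 * star ((1 - Complex.I) / 2) = 1 / 2 := by
      apply Complex.ext <;> simp <;> norm_num
    have h3 : (1 + Complex.I) / 2 * star ((1 - Complex.I) / 2) = Complex.I / 2 := by
      apply Complex.ext <;> simp
      norm_num
    have h4 : (1 - Complex.I) / 2 * star ((1 + Complex.I) / 2) = -Complex.I / 2 := by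
      apply Complex.ext <;> simp <;> norm_num
    rw [h1, h2, h3, h4]
    module⟩

/-- The transposition matrix as a unitary. -/
noncomputable def unitarySwap {d : ℕ} (i j : Fin d) : Matrix.unitaryGroup (Fin d) ℂ :=
  ⟨Matrix.swap ℂ i j, by
    rw [Matrix.mem_unitaryGroup_iff, star_eq_conjTranspose, conjTranspose_swap, swap_mul_self]⟩

/-- The diagonal unitary multiplying the `i`-th coordinate by `Complex.I`. -/
noncomputable def unitaryPhase {d : ℕ} (i : Fin d) : Matrix.unitaryGroup (Fin d) ℂ :=
  ⟨diagonal (Function.update 1 i Complex.I), by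
    rw [Matrix.mem_unitaryGroup_iff, star_eq_conjTranspose, diagonal_conjTranspose,
      diagonal_mul_diagonal, ← diagonal_one]
    congr 1
    ext k
    by_cases hk : k = i
    · subst hk
      simp
    · simp [hk]⟩

section Haar

variable {d : ℕ} [MeasurableSpace (Matrix.unitaryGroup (Fin d) ℂ)]
  [BorelSpace (Matrix.unitaryGroup (Fin d) ℂ)] (μ : Measure (Matrix.unitaryGroup (Fin d) ℂ))
  {v : Fin d → ℂ}

lemma integral_orbit_mulVec [μ.IsHaarMeasure] (V : Matrix.unitaryGroup (Fin d) ℂ)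
    (v : Fin d → ℂ) (F : (Fin d → ℂ) → ℝ) :
    ∫ U, F (V.1 *ᵥ (U.1 *ᵥ v)) ∂μ = ∫ U, F (U.1 *ᵥ v) ∂μ := by
  rw [← integral_mul_left_eq_self (fun U : Matrix.unitaryGroup (Fin d) ℂ ↦ F (U.1 *ᵥ v)) V]
  simp [mulVec_mulVec]

lemma integral_normSq_sq_eq [μ.IsHaarMeasure] (v : Fin d → ℂ)
    (i j : Fin d) :
    ∫ U, Complex.normSq ((U.1 *ᵥ v) j) ^ 2 ∂μ = ∫ U, Complex.normSq ((U.1 *ᵥ v) i) ^ 2 ∂μ := by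
  rw [← integral_orbit_mulVec μ (unitarySwap i j) v fun u ↦ Complex.normSq (u i) ^ 2]
  simp [unitarySwap]

lemma integrable_orbit [IsProbabilityMeasure μ] (hv : ∑ i, Complex.normSq (v i) = 1)
    {F : (Fin d → ℂ) → ℝ} (hF : Continuous F) :
    Integrable (fun U : Matrix.unitaryGroup (Fin d) ℂ ↦ F (U.1 *ᵥ v)) μ := by
  obtain ⟨C, hC⟩ := (isCompact_closedBall (0 : Fin d → ℂ) 1).exists_bound_of_continuousOn
    hF.continuousOn
  have hc : Continuous (fun U : Matrix.unitaryGroup (Fin d) ℂ ↦ F (U.1 *ᵥ v)) :=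
    hF.comp (continuous_subtype_val.matrix_mulVec continuous_const)
  refine Integrable.of_bound hc.aestronglyMeasurable C (ae_of_all _ fun U ↦ hC _ ?_)
  rw [mem_closedBall_zero_iff, pi_norm_le_iff_of_nonneg zero_le_one]
  intro i
  have h : Complex.normSq ((U.1 *ᵥ v) i) ≤ 1 := by
    rw [← hv, ← sum_normSq_unitary_mulVec_s12 U v]
    exact Finset.single_le_sum (f := fun i ↦ Complex.normSq ((U.1 *ᵥ v) i))
      (fun i _ ↦ Complex.normSq_nonneg _) (Finset.mem_univ i)
  rw [Complex.normSq_eq_norm_sq] at h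
  exact (sq_le_one_iff₀ (norm_nonneg _)).mp h

variable [μ.IsHaarMeasure] [IsProbabilityMeasure μ]

lemma integral_normSq (hv : ∑ i, Complex.normSq (v i) = 1) (i : Fin d) :
    ∫ U, Complex.normSq ((U.1 *ᵥ v) i) ∂μ = 1 / d := by
  have hsym : ∀ j, ∫ U, Complex.normSq ((U.1 *ᵥ v) j) ∂μ
      = ∫ U, Complex.normSq ((U.1 *ᵥ v) i) ∂μ := by
    intro j
    rw [← integral_orbit_mulVec μ (unitarySwap i j) v fun u ↦ Complex.normSq (u i)]
    simp [unitarySwap]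
  have hsum : ∑ j, ∫ U, Complex.normSq ((U.1 *ᵥ v) j) ∂μ = 1 := by
    rw [← integral_finsetSum _ fun j _ ↦ integrable_orbit μ hv
      (F := fun u ↦ Complex.normSq (u j))
      (Complex.continuous_normSq.comp (continuous_apply j))]
    simp [sum_normSq_unitary_mulVec_s12, hv]
  rw [Finset.sum_congr rfl fun j _ ↦ hsym j] at hsum
  simp only [Finset.sum_const, Finset.card_univ, Fintype.card_fin, nsmul_eq_mul] at hsum
  exact eq_one_div_of_mul_eq_one_right hsum

lemma integral_normSq_mul_of_ne (hv : ∑ i, Complex.normSq (v i) = 1) {i j : Fin d} (hij : i ≠ j) :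
    ∫ U, Complex.normSq ((U.1 *ᵥ v) i) * Complex.normSq ((U.1 *ᵥ v) j) ∂μ
      = (∫ U, Complex.normSq ((U.1 *ᵥ v) i) ^ 2 ∂μ) / 2 := by
  have hc : ∀ k : Fin d, Continuous fun u : Fin d → ℂ ↦ Complex.normSq (u k) := fun k ↦
    Complex.continuous_normSq.comp (continuous_apply k)
  have hconj : Continuous fun u : Fin d → ℂ ↦ u i * (starRingEnd ℂ) (u j) :=
    (continuous_apply i).mul (Complex.continuous_conj.comp (continuous_apply j))
  have hre := integrable_orbit μ hv (F := fun u ↦ (u i * (starRingEnd ℂ) (u j)).re ^ 2)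
    ((Complex.continuous_re.comp hconj).pow 2)
  have him := integrable_orbit μ hv (F := fun u ↦ (u i * (starRingEnd ℂ) (u j)).im ^ 2)
    ((Complex.continuous_im.comp hconj).pow 2)
  have hxx := integrable_orbit μ hv (F := fun u ↦ Complex.normSq (u i) ^ 2) ((hc i).pow 2)
  have hyy := integrable_orbit μ hv (F := fun u ↦ Complex.normSq (u j) ^ 2) ((hc j).pow 2)
  have hxy := integrable_orbit μ hv (F := fun u ↦ Complex.normSq (u i) * Complex.normSq (u j))
    ((hc i).mul (hc j))
  have hphase := integral_orbit_mulVec μ (unitaryPhase i) v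
    fun u ↦ (u i * (starRingEnd ℂ) (u j)).re ^ 2
  simp only [unitaryPhase, mulVec_diagonal, Function.update_self,
    Function.update_of_ne hij.symm, Pi.one_apply, one_mul, mul_assoc, Complex.I_mul_re,
    neg_sq] at hphase
  have hsplit : ∫ U, Complex.normSq ((U.1 *ᵥ v) i) * Complex.normSq ((U.1 *ᵥ v) j) ∂μ
      = ∫ U, ((U.1 *ᵥ v) i * (starRingEnd ℂ) ((U.1 *ᵥ v) j)).re ^ 2 ∂μ
        + ∫ U, ((U.1 *ᵥ v) i * (starRingEnd ℂ) ((U.1 *ᵥ v) j)).im ^ 2 ∂μ := by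
    rw [← integral_add hre him]
    refine integral_congr_ae (ae_of_all _ fun U ↦ ?_)
    simp only
    rw [← Complex.normSq_conj ((U.1 *ᵥ v) j), ← Complex.normSq_mul, Complex.normSq_apply]
    ring
  have hroot := integral_orbit_mulVec μ (sqrtSwap i j) v
    fun u ↦ Complex.normSq (u i) * Complex.normSq (u j)
  have hpoint : ∀ u : Fin d → ℂ, Complex.normSq (((sqrtSwap i j).1 *ᵥ u) i)
      * Complex.normSq (((sqrtSwap i j).1 *ᵥ u) j)
      = (1 / 4) * Complex.normSq (u i) ^ 2 + (1 / 4) * Complex.normSq (u j) ^ 2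
        + (1 / 2) * (Complex.normSq (u i) * Complex.normSq (u j))
        - (u i * (starRingEnd ℂ) (u j)).im ^ 2 := by
    intro u
    simp only [sqrtSwap, add_mulVec, smul_mulVec, one_mulVec, swap_mulVec, Pi.add_apply,
      Pi.smul_apply, smul_eq_mul, Function.comp_apply, Equiv.swap_apply_left,
      Equiv.swap_apply_right, Complex.normSq_apply]
    simp
    ring
  simp only [hpoint] at hroot
  rw [integral_sub (((hxx.const_mul _).fun_add (hyy.const_mul _)).fun_add (hxy.const_mul _)) him,
    integral_add ((hxx.const_mul _).fun_add (hyy.const_mul _)) (hxy.const_mul _),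
    integral_add (hxx.const_mul _) (hyy.const_mul _), integral_const_mul, integral_const_mul,
    integral_const_mul, integral_normSq_sq_eq μ v i j] at hroot
  linarith

lemma integral_normSq_mul (hv : ∑ i, Complex.normSq (v i) = 1) (i j : Fin d) :
    ∫ U, Complex.normSq ((U.1 *ᵥ v) i) * Complex.normSq ((U.1 *ᵥ v) j) ∂μ
      = (1 + if i = j then 1 else 0) / (d * (d + 1)) := by
  have hd : (0 : ℝ) < d := by exact_mod_cast i.pos
  set a : ℝ := ∫ U, Complex.normSq ((U.1 *ᵥ v) i) ^ 2 ∂μ with ha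
  have hM : ∀ k l, ∫ U, Complex.normSq ((U.1 *ᵥ v) k) * Complex.normSq ((U.1 *ᵥ v) l) ∂μ
      = a / 2 * (1 + if k = l then 1 else 0) := by
    intro k l
    by_cases hkl : k = l
    · subst hkl
      simp only [← sq, if_true]
      rw [integral_normSq_sq_eq μ v i k]
      ring
    · rw [integral_normSq_mul_of_ne μ hv hkl, integral_normSq_sq_eq μ v i k, if_neg hkl]
      ring
  have hsum : ∑ k, ∑ l, ∫ U, Complex.normSq ((U.1 *ᵥ v) k) * Complex.normSq ((U.1 *ᵥ v) l) ∂μ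
      = 1 := by
    have hint : ∀ k l : Fin d, Integrable (fun U : Matrix.unitaryGroup (Fin d) ℂ ↦
        Complex.normSq ((U.1 *ᵥ v) k) * Complex.normSq ((U.1 *ᵥ v) l)) μ := fun k l ↦
      integrable_orbit μ hv (F := fun u ↦ Complex.normSq (u k) * Complex.normSq (u l))
        ((Complex.continuous_normSq.comp (continuous_apply k)).mul
          (Complex.continuous_normSq.comp (continuous_apply l)))
    simp_rw [← integral_finsetSum _ fun l _ ↦ hint _ l]
    rw [← integral_finsetSum _ fun k _ ↦ integrable_finsetSum _ fun l _ ↦ hint k l]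
    simp [← Finset.mul_sum, sum_normSq_unitary_mulVec_s12, hv]
  simp only [hM, ← Finset.mul_sum, Finset.sum_add_distrib, Finset.sum_ite_eq, Finset.mem_univ,
    if_true, Finset.sum_const, Finset.card_univ, Fintype.card_fin, nsmul_eq_mul, mul_one] at hsum
  rw [hM, eq_div_iff (by positivity)]
  linear_combination (1 + if i = j then (1 : ℝ) else 0) * hsum

end Haar

/-- Expansion of `Tr(U v v* U* A)` in the eigenbasis of `A`. -/
lemma re_trace_conj_vecMulVec_mul {d : ℕ} {A : Matrix (Fin d) (Fin d) ℂ} (hA : A.IsHermitian)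
    (U : Matrix (Fin d) (Fin d) ℂ) (v : Fin d → ℂ) :
    ((U * vecMulVec v (star v) * star U * A).trace).re
      = ∑ i, hA.eigenvalues i *
        Complex.normSq (((star hA.eigenvectorUnitary).1 *ᵥ (U *ᵥ v)) i) := by
  have hs := hA.spectral_theorem
  rw [Unitary.conjStarAlgAut_apply] at hs
  set W := hA.eigenvectorUnitary
  set w := (star W).1 *ᵥ (U *ᵥ v) with hw
  have h1 : (U * vecMulVec v (star v) * star U * A).trace
      = star w ⬝ᵥ (diagonal (RCLike.ofReal ∘ hA.eigenvalues) *ᵥ w) := by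
    rw [mul_vecMulVec, vecMulVec_mul, star_eq_conjTranspose, ← star_mulVec, vecMulVec_mul,
      trace_vecMulVec, dotProduct_comm, ← dotProduct_mulVec]
    conv_lhs => rw [hs]
    simp only [hw, mulVec_mulVec, star_mulVec, ← dotProduct_mulVec]
    simp [star_eq_conjTranspose, Matrix.mul_assoc]
  rw [h1]
  simp only [dotProduct, mulVec_diagonal, Pi.star_apply, RCLike.star_def, Complex.re_sum,
    Function.comp_apply]
  refine Finset.sum_congr rfl fun i _ ↦ ?_
  simp [Complex.normSq_apply]
  ring

lemma re_trace_mul_self_eq_sum_eigenvalues_sq {d : ℕ} {A : Matrix (Fin d) (Fin d) ℂ}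
    (hA : A.IsHermitian) : ((A * A).trace).re = ∑ i, hA.eigenvalues i ^ 2 := by
  have hs := hA.spectral_theorem
  have h : (A * A).trace = (diagonal (RCLike.ofReal ∘ hA.eigenvalues : Fin d → ℂ)
      * diagonal (RCLike.ofReal ∘ hA.eigenvalues)).trace := by
    conv_lhs => rw [hs]
    rw [← map_mul, Unitary.conjStarAlgAut_apply, trace_mul_cycle]
    simp
  rw [h, diagonal_mul_diagonal, trace_diagonal, Complex.re_sum]
  exact Finset.sum_congr rfl fun i _ ↦ by simp [sq]

/-- for the Haar probability measure `μ` on `U(d)`, a rank-one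
orthogonal projection `ρ`, and a Hermitian `A`, the variance of the real random
variable `U ↦ Tr(U ρ U* A)` equals
`(Tr(A²) + Tr(A)²)/(d(d+1)) − Tr(A)²/d²`, which is at most `‖A‖_HS²/d²`. -/
theorem stmt12 (d : ℕ) (hd : 1 ≤ d)
    [MeasurableSpace (Matrix.unitaryGroup (Fin d) ℂ)]
    [BorelSpace (Matrix.unitaryGroup (Fin d) ℂ)]
    (μ : Measure (Matrix.unitaryGroup (Fin d) ℂ))
    [μ.IsHaarMeasure] [IsProbabilityMeasure μ]
    (ρ : Matrix (Fin d) (Fin d) ℂ)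
    (hρ : ρ.IsHermitian) (hρ2 : ρ * ρ = ρ) (hρrank : ρ.rank = 1)
    (A : Matrix (Fin d) (Fin d) ℂ) (hA : A.IsHermitian) :
    (∫ U : Matrix.unitaryGroup (Fin d) ℂ,
        (((U : Matrix (Fin d) (Fin d) ℂ) * ρ * star (U : Matrix (Fin d) (Fin d) ℂ) * A).trace).re ^ 2 ∂μ
      - (∫ U : Matrix.unitaryGroup (Fin d) ℂ,
        (((U : Matrix (Fin d) (Fin d) ℂ) * ρ * star (U : Matrix (Fin d) (Fin d) ℂ) * A).trace).re ∂μ) ^ 2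
      = (((A * A).trace).re + ((A.trace).re) ^ 2) / (d * (d + 1)) - ((A.trace).re) ^ 2 / d ^ 2) ∧
    ((((A * A).trace).re + ((A.trace).re) ^ 2) / (d * (d + 1)) - ((A.trace).re) ^ 2 / d ^ 2 ≤
      Real.sqrt (((Aᴴ * A).trace).re) ^ 2 / d ^ 2) := by
  have hd0 : (0 : ℝ) < d := by exact_mod_cast hd
  have htr : (A.trace).re = ∑ i, hA.eigenvalues i := by
    simp [hA.trace_eq_sum_eigenvalues]
  have htr2 := re_trace_mul_self_eq_sum_eigenvalues_sq hA
  obtain ⟨v, rfl, hv⟩ := exists_unit_vector_of_rank_one hρ hρ2 hρrank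
  have hc : ∀ k : Fin d, Continuous fun u : Fin d → ℂ ↦ Complex.normSq (u k) := fun k ↦
    Complex.continuous_normSq.comp (continuous_apply k)
  refine ⟨?_, ?_⟩
  · simp only [re_trace_conj_vecMulVec_mul hA]
    rw [integral_orbit_mulVec μ (star hA.eigenvectorUnitary) v
        fun u ↦ ∑ i, hA.eigenvalues i * Complex.normSq (u i),
      integral_orbit_mulVec μ (star hA.eigenvectorUnitary) v
        fun u ↦ (∑ i, hA.eigenvalues i * Complex.normSq (u i)) ^ 2]
    have hfirst : ∫ U : Matrix.unitaryGroup (Fin d) ℂ,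
        ∑ i, hA.eigenvalues i * Complex.normSq ((U.1 *ᵥ v) i) ∂μ
        = (∑ i, hA.eigenvalues i) / d := by
      rw [integral_finsetSum _ fun i _ ↦ (integrable_orbit μ hv (hc i)).const_mul _]
      simp only [integral_const_mul, integral_normSq μ hv]
      rw [← Finset.sum_mul, mul_one_div]
    have hsecond : ∫ U : Matrix.unitaryGroup (Fin d) ℂ,
        (∑ i, hA.eigenvalues i * Complex.normSq ((U.1 *ᵥ v) i)) ^ 2 ∂μ
        = (∑ i, hA.eigenvalues i ^ 2 + (∑ i, hA.eigenvalues i) ^ 2) / (d * (d + 1)) := by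
      have hint : ∀ i j : Fin d, Integrable (fun U : Matrix.unitaryGroup (Fin d) ℂ ↦
          hA.eigenvalues i * hA.eigenvalues j *
            (Complex.normSq ((U.1 *ᵥ v) i) * Complex.normSq ((U.1 *ᵥ v) j))) μ := fun i j ↦
        (integrable_orbit μ hv ((hc i).mul (hc j))).const_mul _
      simp only [sq (∑ i, _ * Complex.normSq _), Finset.sum_mul_sum, mul_mul_mul_comm]
      rw [integral_finsetSum _ fun i _ ↦ integrable_finsetSum _ fun j _ ↦ hint i j]
      simp_rw [integral_finsetSum _ fun j _ ↦ hint _ j, integral_const_mul,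
        integral_normSq_mul μ hv, ← mul_div_assoc, ← Finset.sum_div]
      congr 1
      simp only [mul_add, mul_one, mul_ite, mul_zero, Finset.sum_add_distrib, Finset.sum_ite_eq,
        Finset.mem_univ, if_true, sq, Finset.sum_mul_sum]
      rw [add_comm]
    rw [hfirst, hsecond, htr, htr2, div_pow]
  · have h0 : 0 ≤ ((A * A).trace).re := by
      rw [htr2]
      positivity
    rw [hA.eq, Real.sq_sqrt h0, add_div]
    have hle : (d : ℝ) ^ 2 ≤ d * (d + 1) := by nlinarith
    have h1 : ((A * A).trace).re / (d * (d + 1)) ≤ ((A * A).trace).re / d ^ 2 := by gcongr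
    have h2 : (A.trace).re ^ 2 / (d * (d + 1)) ≤ (A.trace).re ^ 2 / d ^ 2 := by gcongr
    linarith
end
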